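/- Let φ : [0,∞) → [0,∞) be continuous, increasing and subadditive (φ(s+t) ≤ φ(s) + φ(t) for all s,t ≥ 0) with φ(0) = 0 and φ(t) → ∞ as t → ∞ (concavity is not assumed). Let f : ℝ^n → ℝ be measurable and K > 0, and suppose that for every axis-parallel cube Q there exists c_Q ∈ ℝ with ⨍_Q φ(|f − c_Q|/K) dx ≤ 1. Then for every axis-parallel cube Q there exists c ∈ ℝ with ⨍_Q |f − c| dx ≤ ( 2 φ⁻¹(4) + φ⁻¹(2 + 2^{n+2}) ) · K. -/

import Mathlib

open MeasureTheory Set Filter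

/-- An axis-parallel cube of positive side length in `ℝⁿ`. -/
def IsCube (n : ℕ) (Q : Set (Fin n → ℝ)) : Prop :=
  ∃ (a : Fin n → ℝ) (h : ℝ), 0 < h ∧ Q = Set.univ.pi fun i => Set.Icc (a i) (a i + h)

open scoped ENNReal Topology

section DyadicCubes

variable {n : ℕ}

/-- The half-open axis-parallel cube with lower corner `a` and side length `h`. -/
def halfOpenCube (a : Fin n → ℝ) (h : ℝ) : Set (Fin n → ℝ) :=
  Set.univ.pi fun i => Set.Ico (a i) (a i + h)

/-- The index of the cell containing `x` in the partition of `ℝⁿ` into half-open cubes of side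
length `h / 2 ^ k` whose corners lie on the grid based at `a`. -/
noncomputable def dyadicIndex (a : Fin n → ℝ) (h : ℝ) (k : ℕ) (x : Fin n → ℝ) : Fin n → ℤ :=
  fun i => ⌊(x i - a i) / (h / 2 ^ k)⌋

/-- The half-open cell of generation `k` containing `x`. -/
noncomputable def dyadicCell (a : Fin n → ℝ) (h : ℝ) (k : ℕ) (x : Fin n → ℝ) :
    Set (Fin n → ℝ) :=
  halfOpenCube (fun i => a i + h / 2 ^ k * dyadicIndex a h k x i) (h / 2 ^ k)

theorem volume_halfOpenCube (a : Fin n → ℝ) (h : ℝ) :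
    volume (halfOpenCube a h) = ENNReal.ofReal h ^ n := by
  simp [halfOpenCube, Real.volume_pi_Ico]

theorem measurableSet_halfOpenCube (a : Fin n → ℝ) (h : ℝ) :
    MeasurableSet (halfOpenCube a h) :=
  MeasurableSet.univ_pi fun _ => measurableSet_Ico

theorem halfOpenCube_ae_eq (a : Fin n → ℝ) (h : ℝ) :
    halfOpenCube a h =ᵐ[volume] Set.univ.pi fun i => Set.Icc (a i) (a i + h) :=
  Measure.pi_Ico_ae_eq_pi_Icc

theorem halfOpenCube_ae_eq_closedBall (a : Fin n → ℝ) {h : ℝ} (hh : 0 ≤ h) :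
    halfOpenCube a h =ᵐ[volume] Metric.closedBall (fun i => a i + h / 2) (h / 2) := by
  refine (halfOpenCube_ae_eq a h).trans ?_
  rw [closedBall_pi _ (by positivity)]
  refine Filter.EventuallyEq.of_eq ?_
  congr 1
  ext1 i
  rw [Real.closedBall_eq_Icc]
  congr 1 <;> ring

theorem mem_dyadicCell_iff {a : Fin n → ℝ} {h : ℝ} (hh : 0 < h) {k : ℕ} {x y : Fin n → ℝ} :
    y ∈ dyadicCell a h k x ↔ dyadicIndex a h k y = dyadicIndex a h k x := by
  have hk : 0 < h / 2 ^ k := by positivity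
  simp only [dyadicCell, halfOpenCube, Set.mem_univ_pi, Set.mem_Ico, funext_iff]
  refine forall_congr' fun i => ?_
  conv_rhs => rw [dyadicIndex, Int.floor_eq_iff, le_div_iff₀ hk, div_lt_iff₀ hk]
  constructor <;> rintro ⟨h1, h2⟩ <;> constructor <;> linarith

theorem self_mem_dyadicCell {a : Fin n → ℝ} {h : ℝ} (hh : 0 < h) (k : ℕ) (x : Fin n → ℝ) :
    x ∈ dyadicCell a h k x :=
  (mem_dyadicCell_iff hh).2 rfl

theorem dyadicIndex_succ_div_two (a : Fin n → ℝ) (h : ℝ) (k : ℕ) (x : Fin n → ℝ) (i : Fin n) :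
    dyadicIndex a h k x i = dyadicIndex a h (k + 1) x i / 2 := by
  have := Int.floor_div_natCast ((x i - a i) / (h / 2 ^ (k + 1))) 2
  simp only [dyadicIndex]
  push_cast at this
  rw [← this]
  congr 1
  rw [pow_succ, div_div_eq_mul_div, div_div_eq_mul_div]
  ring

theorem dyadicIndex_eq_of_le {a : Fin n → ℝ} {h : ℝ} {x y : Fin n → ℝ} {j k : ℕ} (hjk : j ≤ k)
    (hxy : dyadicIndex a h k x = dyadicIndex a h k y) :
    dyadicIndex a h j x = dyadicIndex a h j y := by
  induction hjk with
  | refl => exact hxy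
  | step _ ih =>
    refine ih (funext fun i => ?_)
    rw [dyadicIndex_succ_div_two, hxy, ← dyadicIndex_succ_div_two]

theorem dyadicCell_eq {a : Fin n → ℝ} {h : ℝ} {x y : Fin n → ℝ} {k : ℕ}
    (hxy : dyadicIndex a h k x = dyadicIndex a h k y) :
    dyadicCell a h k x = dyadicCell a h k y := by
  simp only [dyadicCell, hxy]

theorem dyadicCell_subset_of_le {a : Fin n → ℝ} {h : ℝ} (hh : 0 < h) (x : Fin n → ℝ) {j k : ℕ}
    (hjk : j ≤ k) : dyadicCell a h k x ⊆ dyadicCell a h j x := fun _ hy =>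
  (mem_dyadicCell_iff hh).2 (dyadicIndex_eq_of_le hjk ((mem_dyadicCell_iff hh).1 hy))

theorem dyadicCell_zero {a : Fin n → ℝ} {h : ℝ} (hh : 0 < h) {x : Fin n → ℝ}
    (hx : x ∈ halfOpenCube a h) : dyadicCell a h 0 x = halfOpenCube a h := by
  have h0 : dyadicIndex a h 0 x = 0 := by
    ext i
    have hi := hx i (Set.mem_univ i)
    simp only [dyadicIndex, pow_zero, div_one, Pi.zero_apply, Int.floor_eq_zero_iff, Set.mem_Ico]
    refine ⟨div_nonneg (by linarith [hi.1]) hh.le, (div_lt_one hh).2 (by linarith [hi.2])⟩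
  simp [dyadicCell, h0]

theorem volume_dyadicCell (a : Fin n → ℝ) {h : ℝ} (hh : 0 < h) (k : ℕ) (x : Fin n → ℝ) :
    volume (dyadicCell a h k x) = 2 ^ n * volume (dyadicCell a h (k + 1) x) := by
  simp only [dyadicCell, volume_halfOpenCube]
  rw [← mul_pow]
  congr 1
  rw [show (2 : ℝ≥0∞) = ENNReal.ofReal 2 by simp, ← ENNReal.ofReal_mul (by norm_num)]
  congr 1
  field_simp
  ring

/-- **Dyadic Lebesgue differentiation**: the averages of an integrable function over the cells
containing `x` converge to its value at almost every `x`. -/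
theorem ae_tendsto_lintegral_dyadicCell_div (a : Fin n → ℝ) {h : ℝ} (hh : 0 < h)
    {g : (Fin n → ℝ) → ℝ≥0∞} (hg : Measurable g) (hfin : ∫⁻ y, g y ≠ ∞) :
    ∀ᵐ x, Tendsto (fun k => (∫⁻ y in dyadicCell a h k x, g y) / volume (dyadicCell a h k x))
      atTop (𝓝 (g x)) := by
  have hpos (k : ℕ) : 0 < h / 2 ^ k := by positivity
  filter_upwards [(IsUnifLocDoublingMeasure.vitaliFamily (volume : Measure (Fin n → ℝ))
    1).ae_tendsto_lintegral_div hg.aemeasurable hfin] with x hx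
  have hlim : Tendsto (fun k : ℕ => h / 2 ^ k / 2) atTop (𝓝[>] 0) := by
    refine tendsto_nhdsWithin_iff.2 ⟨?_, Eventually.of_forall fun k => half_pos (hpos k)⟩
    have := (tendsto_pow_atTop_nhds_zero_of_lt_one (r := (1 / 2 : ℝ)) (by norm_num)
      (by norm_num)).const_mul (h / 2)
    rw [mul_zero] at this
    refine this.congr fun k => ?_
    rw [one_div, inv_pow]
    ring
  have hball := hx.comp (IsUnifLocDoublingMeasure.tendsto_closedBall_filterAt
    (volume : Measure (Fin n → ℝ))
    (fun k i => a i + h / 2 ^ k * dyadicIndex a h k x i + h / 2 ^ k / 2) _ hlim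
    (Eventually.of_forall fun k => ?_))
  · refine hball.congr fun k => ?_
    have hae := halfOpenCube_ae_eq_closedBall
      (fun i => a i + h / 2 ^ k * dyadicIndex a h k x i) (hpos k).le
    simp only [Function.comp_apply, dyadicCell]
    rw [setLIntegral_congr hae, measure_congr hae]
  · rw [one_mul, closedBall_pi _ (half_pos (hpos k)).le]
    intro i hi
    have := self_mem_dyadicCell (a := a) hh k x i hi
    simp only [Real.closedBall_eq_Icc, Set.mem_Icc, Set.mem_Ico] at this ⊢
    constructor <;> linarith [this.1, this.2]

/-- A **Calderón–Zygmund** stopping-time estimate. If `u ≤ A` wherever `g ≤ L`, and `u` is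
dominated in integral by `C * g` over the subcubes where the average of `g` lies between `L` and
`2 ^ n * L`, then `∫ u ≤ A |Q| + C ∫ g` over the whole cube `Q`. -/
theorem lintegral_halfOpenCube_le_of_stopping (a : Fin n → ℝ) {h : ℝ} (hh : 0 < h)
    {g u : (Fin n → ℝ) → ℝ≥0∞} (hg : Measurable g)
    (hfin : ∫⁻ y in halfOpenCube a h, g y ≠ ∞) (L A C : ℝ≥0∞)
    (hroot : ∫⁻ y in halfOpenCube a h, g y ≤ L * volume (halfOpenCube a h))
    (hsmall : ∀ x, g x ≤ L → u x ≤ A)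
    (hbad : ∀ (b : Fin n → ℝ) (r : ℝ), 0 < r → halfOpenCube b r ⊆ halfOpenCube a h →
      L * volume (halfOpenCube b r) ≤ ∫⁻ y in halfOpenCube b r, g y →
      ∫⁻ y in halfOpenCube b r, g y ≤ 2 ^ n * L * volume (halfOpenCube b r) →
      ∫⁻ y in halfOpenCube b r, u y ≤ C * ∫⁻ y in halfOpenCube b r, g y) :
    ∫⁻ y in halfOpenCube a h, u y
      ≤ A * volume (halfOpenCube a h) + C * ∫⁻ y in halfOpenCube a h, g y := by
  set Q := halfOpenCube a h with hQ
  have hQm : MeasurableSet Q := measurableSet_halfOpenCube a h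
  let bad (k : ℕ) (x : Fin n → ℝ) : Prop :=
    L * volume (dyadicCell a h k x) < ∫⁻ y in dyadicCell a h k x, g y
  let E (p : ℕ × (Fin n → ℤ)) : Set (Fin n → ℝ) :=
    {x | dyadicIndex a h p.1 x = p.2 ∧ x ∈ Q ∧ bad p.1 x ∧ ∀ j < p.1, ¬ bad j x}
  have bad_congr {k : ℕ} {x y : Fin n → ℝ} (hxy : dyadicIndex a h k x = dyadicIndex a h k y) :
      bad k x ↔ bad k y := by
    simp only [bad, dyadicCell_eq hxy]
  have hE_sub (p) : E p ⊆ Q := fun x hx => hx.2.1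
  have hE_cell (p) (x) (hx : x ∈ E p) : E p = dyadicCell a h p.1 x := by
    obtain ⟨hx1, hx2, hx3, hx4⟩ := hx
    ext y
    rw [mem_dyadicCell_iff hh]
    refine ⟨fun hy => hy.1.trans hx1.symm, fun hy => ⟨hy.trans hx1, ?_, (bad_congr hy).2 hx3,
      fun j hj => (bad_congr (dyadicIndex_eq_of_le hj.le hy)).not.2 (hx4 j hj)⟩⟩
    rw [hQ, ← dyadicCell_zero hh hx2]
    exact (mem_dyadicCell_iff hh).2 (dyadicIndex_eq_of_le (Nat.zero_le _) hy)
  have hE_meas (p) : MeasurableSet (E p) := by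
    rcases (E p).eq_empty_or_nonempty with he | ⟨x, hx⟩
    · rw [he]; exact MeasurableSet.empty
    · rw [hE_cell p x hx]; exact measurableSet_halfOpenCube _ _
  have hE_disj : Pairwise (Function.onFun Disjoint E) := by
    intro p q hpq
    refine Set.disjoint_left.2 fun x hp hq => hpq ?_
    have h1 : p.1 = q.1 := by
      rcases lt_trichotomy p.1 q.1 with hlt | heq | hlt
      · exact absurd hp.2.2.1 (hq.2.2.2 _ hlt)
      · exact heq
      · exact absurd hq.2.2.1 (hp.2.2.2 _ hlt)
    exact Prod.ext h1 (by rw [← hp.1, ← hq.1, h1])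
  have hE_le (p) : ∫⁻ y in E p, u y ≤ C * ∫⁻ y in E p, g y := by
    rcases (E p).eq_empty_or_nonempty with he | ⟨x, hx⟩
    · simp [he]
    have hsub := hE_sub p
    rw [hE_cell p x hx] at hsub ⊢
    obtain ⟨k, m⟩ := p
    obtain ⟨-, hxQ, hxbad, hxgood⟩ := hx
    refine hbad _ _ (by positivity) hsub hxbad.le ?_
    cases k with
    | zero =>
      exact absurd hxbad (by simpa only [bad, dyadicCell_zero hh hxQ, not_lt] using hroot)
    | succ k =>
      calc ∫⁻ y in dyadicCell a h (k + 1) x, g y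
          ≤ ∫⁻ y in dyadicCell a h k x, g y :=
            lintegral_mono_set (dyadicCell_subset_of_le hh x k.le_succ)
        _ ≤ L * volume (dyadicCell a h k x) := not_lt.1 (hxgood k k.lt_succ_self)
        _ = 2 ^ n * L * volume (dyadicCell a h (k + 1) x) := by
            rw [volume_dyadicCell a hh]; ring
  have hD_meas : MeasurableSet (⋃ p, E p) := MeasurableSet.iUnion hE_meas
  have hD_sub : (⋃ p, E p) ⊆ Q := Set.iUnion_subset hE_sub
  have hD : ∫⁻ y in ⋃ p, E p, u y ≤ C * ∫⁻ y in Q, g y :=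
    calc ∫⁻ y in ⋃ p, E p, u y ≤ ∑' p, ∫⁻ y in E p, u y := lintegral_iUnion_le _ _
      _ ≤ ∑' p, C * ∫⁻ y in E p, g y := ENNReal.tsum_le_tsum hE_le
      _ = C * ∫⁻ y in ⋃ p, E p, g y := by
          rw [ENNReal.tsum_mul_left, lintegral_iUnion hE_meas hE_disj]
      _ ≤ C * ∫⁻ y in Q, g y := by gcongr
  have hG : ∫⁻ y in Q \ ⋃ p, E p, u y ≤ A * volume Q := by
    have hfin' : ∫⁻ y, Q.indicator g y ≠ ∞ := by rwa [lintegral_indicator hQm]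
    have hae : ∀ᵐ x, x ∈ Q \ ⋃ p, E p → u x ≤ A := by
      filter_upwards [ae_tendsto_lintegral_dyadicCell_div a hh (hg.indicator hQm) hfin']
        with x hx hxG
      refine hsmall x ?_
      rw [Set.indicator_of_mem hxG.1] at hx
      have hgood (k : ℕ) : ¬ bad k x := by
        classical
        intro hk
        have hex : ∃ k, bad k x := ⟨k, hk⟩
        exact hxG.2 (Set.mem_iUnion.2 ⟨(Nat.find hex, dyadicIndex a h (Nat.find hex) x),
          rfl, hxG.1, Nat.find_spec hex, fun j hj => Nat.find_min hex hj⟩)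
      refine le_of_tendsto' hx fun k => ENNReal.div_le_of_le_mul ?_
      exact (lintegral_mono (Set.indicator_le_self Q g)).trans (not_lt.1 (hgood k))
    calc ∫⁻ y in Q \ ⋃ p, E p, u y ≤ ∫⁻ _ in Q \ ⋃ p, E p, A :=
          setLIntegral_mono_ae' (hQm.diff hD_meas) hae
      _ = A * volume (Q \ ⋃ p, E p) := setLIntegral_const _ _
      _ ≤ A * volume Q := by gcongr; exact Set.sdiff_subset
  calc ∫⁻ y in Q, u y = ∫⁻ y in (Q \ ⋃ p, E p) ∪ ⋃ p, E p, u y := by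
        rw [Set.sdiff_union_of_subset hD_sub]
    _ ≤ (∫⁻ y in Q \ ⋃ p, E p, u y) + ∫⁻ y in ⋃ p, E p, u y := lintegral_union_le _ _ _
    _ ≤ A * volume Q + C * ∫⁻ y in Q, g y := add_le_add hG hD

end DyadicCubes

section TruncatedOscillation

variable {n : ℕ} {φ : ℝ → ℝ} {f : (Fin n → ℝ) → ℝ} {c : (Fin n → ℝ) → ℝ → ℝ}

theorem volume_halfOpenCube_ne_zero (a : Fin n → ℝ) {h : ℝ} (hh : 0 < h) :
    volume (halfOpenCube a h) ≠ 0 := by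
  rw [volume_halfOpenCube]
  exact pow_ne_zero _ (ENNReal.ofReal_pos.2 hh).ne'

theorem volume_halfOpenCube_ne_top (a : Fin n → ℝ) (h : ℝ) :
    volume (halfOpenCube a h) ≠ ∞ := by
  rw [volume_halfOpenCube]
  exact ENNReal.pow_ne_top ENNReal.ofReal_ne_top

theorem measurable_ofReal_comp_abs_sub (hcont : ContinuousOn φ (Set.Ici 0)) (hf : Measurable f)
    (d : ℝ) : Measurable fun x => ENNReal.ofReal (φ |f x - d|) := by
  have hφ : Continuous fun t : ℝ => φ |t| :=
    hcont.comp_continuous continuous_abs fun t => abs_nonneg t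
  exact (hφ.measurable.comp (hf.sub_const d)).ennreal_ofReal

/-- If `f` has `φ`-averages at most `1` and `N` about the constants `d` and `e` on a set, then
`φ |d - e| ≤ 1 + N`. -/
theorem apply_abs_sub_le_of_lintegral_le (hcont : ContinuousOn φ (Set.Ici 0))
    (hmono : MonotoneOn φ (Set.Ici 0))
    (hsubadd : ∀ s t : ℝ, 0 ≤ s → 0 ≤ t → φ (s + t) ≤ φ s + φ t)
    (hf : Measurable f) {S : Set (Fin n → ℝ)} (hS0 : volume S ≠ 0) (hS : volume S ≠ ∞) {d e N : ℝ}
    (hN : 0 ≤ N)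
    (hd : ∫⁻ x in S, ENNReal.ofReal (φ |f x - d|) ≤ volume S)
    (he : ∫⁻ x in S, ENNReal.ofReal (φ |f x - e|) ≤ ENNReal.ofReal N * volume S) :
    φ |d - e| ≤ 1 + N := by
  rw [← ENNReal.ofReal_le_ofReal_iff (by positivity), ← ENNReal.mul_le_mul_iff_left hS0 hS]
  calc ENNReal.ofReal (φ |d - e|) * volume S
      = ∫⁻ _ in S, ENNReal.ofReal (φ |d - e|) := (setLIntegral_const _ _).symm
    _ ≤ ∫⁻ x in S, ENNReal.ofReal (φ |f x - d|) + ENNReal.ofReal (φ |f x - e|) := by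
        refine lintegral_mono fun x => ?_
        refine le_trans (ENNReal.ofReal_le_ofReal ?_) ENNReal.ofReal_add_le
        refine (hmono (Set.mem_Ici.2 (abs_nonneg _)) (Set.mem_Ici.2 (by positivity)) ?_).trans
          (hsubadd _ _ (abs_nonneg (f x - d)) (abs_nonneg (f x - e)))
        rw [abs_sub_comm (f x) d]
        exact abs_sub_le d (f x) e
    _ = (∫⁻ x in S, ENNReal.ofReal (φ |f x - d|)) + ∫⁻ x in S, ENNReal.ofReal (φ |f x - e|) :=
        lintegral_add_left (measurable_ofReal_comp_abs_sub hcont hf d) _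
    _ ≤ volume S + ENNReal.ofReal N * volume S := add_le_add hd he
    _ = ENNReal.ofReal (1 + N) * volume S := by
        rw [ENNReal.ofReal_add zero_le_one hN, ENNReal.ofReal_one]; ring

theorem min_ofReal_abs_sub_le (T : ℝ≥0∞) {y d e B : ℝ} (hB : |d - e| ≤ B) :
    min (ENNReal.ofReal |y - e|) T ≤ ENNReal.ofReal B + min (ENNReal.ofReal |y - d|) T := by
  rw [← min_add_add_left]
  refine le_min ((min_le_left _ _).trans ?_) ((min_le_right _ _).trans le_add_self)
  rw [← ENNReal.ofReal_add ((abs_nonneg _).trans hB) (abs_nonneg _)]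
  refine ENNReal.ofReal_le_ofReal ?_
  linarith [abs_sub_le y d e]

/-- One Calderón–Zygmund step improves a uniform bound `M` on the truncated oscillation to
`A + (B + M) / 4`. -/
theorem truncated_oscillation_step (hcont : ContinuousOn φ (Set.Ici 0))
    (hmono : MonotoneOn φ (Set.Ici 0))
    (hsubadd : ∀ s t : ℝ, 0 ≤ s → 0 ≤ t → φ (s + t) ≤ φ s + φ t) {A B : ℝ}
    (hA : ∀ t, 0 ≤ t → φ t ≤ 4 → t ≤ A)
    (hB : ∀ t, 0 ≤ t → φ t ≤ 1 + 2 ^ n * 4 → t ≤ B)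
    (hf : Measurable f)
    (hc : ∀ a h, 0 < h →
      ∫⁻ x in halfOpenCube a h, ENNReal.ofReal (φ |f x - c a h|) ≤ volume (halfOpenCube a h))
    {T M : ℝ≥0∞}
    (hM : ∀ a h, 0 < h → ∫⁻ x in halfOpenCube a h, min (ENNReal.ofReal |f x - c a h|) T
      ≤ M * volume (halfOpenCube a h))
    (a : Fin n → ℝ) {h : ℝ} (hh : 0 < h) :
    ∫⁻ x in halfOpenCube a h, min (ENNReal.ofReal |f x - c a h|) T
      ≤ (ENNReal.ofReal A + (ENNReal.ofReal B + M) * 4⁻¹) * volume (halfOpenCube a h) := by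
  have h4 : (4 : ℝ≥0∞) = ENNReal.ofReal 4 := by simp
  refine (lintegral_halfOpenCube_le_of_stopping a hh
    (g := fun x => ENNReal.ofReal (φ |f x - c a h|))
    (measurable_ofReal_comp_abs_sub hcont hf _)
    ((hc a h hh).trans_lt (volume_halfOpenCube_ne_top a h).lt_top).ne
    4 (ENNReal.ofReal A) ((ENNReal.ofReal B + M) * 4⁻¹) ?_ ?_ ?_).trans ?_
  · exact (hc a h hh).trans (le_mul_of_one_le_left' (by norm_num))
  · intro x hx
    rw [h4, ENNReal.ofReal_le_ofReal_iff (by norm_num)] at hx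
    exact (min_le_left _ _).trans (ENNReal.ofReal_le_ofReal (hA _ (abs_nonneg _) hx))
  · intro b r hr _ hlow hup
    have hφ : φ |c b r - c a h| ≤ 1 + 2 ^ n * 4 := by
      refine apply_abs_sub_le_of_lintegral_le hcont hmono hsubadd hf
        (volume_halfOpenCube_ne_zero b hr) (volume_halfOpenCube_ne_top b r) (by positivity)
        (hc b r hr) ?_
      rwa [ENNReal.ofReal_mul (by positivity), ENNReal.ofReal_pow (by norm_num), ← h4,
        ENNReal.ofReal_ofNat]
    calc ∫⁻ x in halfOpenCube b r, min (ENNReal.ofReal |f x - c a h|) T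
        ≤ ∫⁻ x in halfOpenCube b r,
            (ENNReal.ofReal B + min (ENNReal.ofReal |f x - c b r|) T) :=
          lintegral_mono fun x => min_ofReal_abs_sub_le T (hB _ (abs_nonneg _) hφ)
      _ = ENNReal.ofReal B * volume (halfOpenCube b r)
            + ∫⁻ x in halfOpenCube b r, min (ENNReal.ofReal |f x - c b r|) T := by
          rw [lintegral_add_left measurable_const, setLIntegral_const]
      _ ≤ ENNReal.ofReal B * volume (halfOpenCube b r) + M * volume (halfOpenCube b r) := by
          gcongr
          exact hM b r hr
      _ = (ENNReal.ofReal B + M) * 4⁻¹ * (4 * volume (halfOpenCube b r)) := by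
          rw [mul_assoc, ← mul_assoc 4⁻¹, ENNReal.inv_mul_cancel (by norm_num) (by norm_num),
            one_mul, add_mul]
      _ ≤ _ := by gcongr
  · rw [add_mul (ENNReal.ofReal A)]
    exact add_le_add le_rfl (mul_le_mul_right (hc a h hh) _)

/-- The fixed point of the Calderón–Zygmund step bounds the oscillation on every cube. -/
theorem oscillation_le (hcont : ContinuousOn φ (Set.Ici 0))
    (hmono : MonotoneOn φ (Set.Ici 0))
    (hsubadd : ∀ s t : ℝ, 0 ≤ s → 0 ≤ t → φ (s + t) ≤ φ s + φ t) {A B : ℝ}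
    (hA0 : 0 ≤ A) (hB0 : 0 ≤ B)
    (hA : ∀ t, 0 ≤ t → φ t ≤ 4 → t ≤ A)
    (hB : ∀ t, 0 ≤ t → φ t ≤ 1 + 2 ^ n * 4 → t ≤ B)
    (hf : Measurable f)
    (hc : ∀ a h, 0 < h →
      ∫⁻ x in halfOpenCube a h, ENNReal.ofReal (φ |f x - c a h|) ≤ volume (halfOpenCube a h))
    (a : Fin n → ℝ) {h : ℝ} (hh : 0 < h) :
    ∫⁻ x in halfOpenCube a h, ENNReal.ofReal |f x - c a h|
      ≤ ENNReal.ofReal (2 * A + B) * volume (halfOpenCube a h) := by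
  have hT (T : ℕ) : ∫⁻ x in halfOpenCube a h, min (ENNReal.ofReal |f x - c a h|) T
      ≤ ENNReal.ofReal (2 * A + B) * volume (halfOpenCube a h) := by
    let M : ℝ≥0∞ := ⨆ (b : Fin n → ℝ) (r : ℝ) (_ : 0 < r),
      (∫⁻ x in halfOpenCube b r, min (ENNReal.ofReal |f x - c b r|) T) /
        volume (halfOpenCube b r)
    have hM (b : Fin n → ℝ) (r : ℝ) (hr : 0 < r) :
        ∫⁻ x in halfOpenCube b r, min (ENNReal.ofReal |f x - c b r|) T
          ≤ M * volume (halfOpenCube b r) := by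
      rw [← ENNReal.div_le_iff (volume_halfOpenCube_ne_zero b hr)
        (volume_halfOpenCube_ne_top b r)]
      exact le_iSup_of_le b (le_iSup_of_le r (le_iSup_of_le hr le_rfl))
    have hMT : M ≤ T := by
      refine iSup_le fun b => iSup_le fun r => iSup_le fun hr => ENNReal.div_le_of_le_mul ?_
      rw [← setLIntegral_const]
      exact lintegral_mono fun x => min_le_right _ _
    have hstep : M ≤ ENNReal.ofReal A + (ENNReal.ofReal B + M) * 4⁻¹ :=
      iSup_le fun b => iSup_le fun r => iSup_le fun hr => ENNReal.div_le_of_le_mul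
        (truncated_oscillation_step hcont hmono hsubadd hA hB hf hc hM b hr)
    refine (hM a h hh).trans ?_
    gcongr
    lift M to NNReal using (hMT.trans_lt (ENNReal.natCast_lt_top T)).ne with m
    have hreal : (m : ℝ) ≤ A + (B + m) * 4⁻¹ := by
      have := ENNReal.toReal_mono (by finiteness) hstep
      rwa [ENNReal.toReal_add (by finiteness) (by finiteness), ENNReal.toReal_mul,
        ENNReal.toReal_add (by finiteness) (by finiteness), ENNReal.toReal_ofReal hA0,
        ENNReal.toReal_ofReal hB0, ENNReal.coe_toReal, ENNReal.toReal_inv,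
        ENNReal.toReal_ofNat] at this
    rw [← ENNReal.ofReal_coe_nnreal]
    exact ENNReal.ofReal_le_ofReal (by linarith)
  have hsup (x : Fin n → ℝ) : ENNReal.ofReal |f x - c a h|
      = ⨆ T : ℕ, min (ENNReal.ofReal |f x - c a h|) T := by
    rw [← inf_iSup_eq, ENNReal.iSup_natCast, inf_top_eq]
  rw [lintegral_congr hsup, lintegral_iSup]
  · exact iSup_le hT
  · exact fun T => (hf.sub_const _).abs.ennreal_ofReal.min measurable_const
  · intro S T hST x
    exact min_le_min_left _ (Nat.cast_le.2 hST)

end TruncatedOscillation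

/-- Subadditive variant of the main theorem: if `φ : [0,∞) → [0,∞)` is continuous,
increasing and subadditive with `φ(0)=0` and `φ(t) → ∞` (no concavity assumed), and a
measurable `f` satisfies `⨍_Q φ(|f - c_Q|/K) ≤ 1` for every cube `Q`, then for every cube `Q`
there is `c ∈ ℝ` with `⨍_Q |f - c| ≤ (2 φ⁻¹(4) + φ⁻¹(2 + 2^{n+2}))·K`. -/
theorem bmo_phi_implies_bmo_subadditive (n : ℕ) (φ φinv : ℝ → ℝ)
    (hcont : ContinuousOn φ (Set.Ici 0))
    (hmono : StrictMonoOn φ (Set.Ici 0))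
    (hsubadd : ∀ s t : ℝ, 0 ≤ s → 0 ≤ t → φ (s + t) ≤ φ s + φ t)
    (hzero : φ 0 = 0)
    (htop : Tendsto φ atTop atTop)
    (hnonneg : ∀ t, 0 ≤ t → 0 ≤ φ t)
    (hinv_right : ∀ s, 0 ≤ s → φ (φinv s) = s)
    (hinv_left : ∀ t, 0 ≤ t → φinv (φ t) = t)
    (hinv_nonneg : ∀ s, 0 ≤ s → 0 ≤ φinv s)
    (f : (Fin n → ℝ) → ℝ) (hf : Measurable f)
    (K : ℝ) (hK : 0 < K)
    (hyp : ∀ Q : Set (Fin n → ℝ), IsCube n Q → ∃ c : ℝ,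
      ∫⁻ x in Q, ENNReal.ofReal (φ (|f x - c| / K)) ≤ volume Q) :
    ∀ Q : Set (Fin n → ℝ), IsCube n Q → ∃ c : ℝ,
      ∫⁻ x in Q, ENNReal.ofReal |f x - c|
        ≤ ENNReal.ofReal ((2 * φinv 4 + φinv (2 + 2 ^ (n + 2))) * K) * volume Q := by
  have hinv {s t : ℝ} (hs : 0 ≤ s) (ht : 0 ≤ t) (hts : φ t ≤ s) : t ≤ φinv s := by
    rw [← hinv_right s hs] at hts
    exact (hmono.le_iff_le ht (hinv_nonneg s hs)).1 hts
  have hcube (a : Fin n → ℝ) (h : ℝ) (hh : 0 < h) : ∃ d : ℝ,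
      ∫⁻ x in halfOpenCube a h, ENNReal.ofReal (φ |f x / K - d|)
        ≤ volume (halfOpenCube a h) := by
    obtain ⟨d, hd⟩ := hyp _ ⟨a, h, hh, rfl⟩
    refine ⟨d / K, ?_⟩
    rw [setLIntegral_congr (halfOpenCube_ae_eq a h), measure_congr (halfOpenCube_ae_eq a h)]
    simpa only [← sub_div, abs_div, abs_of_pos hK] using hd
  choose! c hc using hcube
  rintro Q ⟨a, h, hh, rfl⟩
  refine ⟨c a h * K, ?_⟩
  have hpow : (0 : ℝ) < 2 ^ n := by positivity
  have key := oscillation_le (A := φinv 4) (B := φinv (2 + 2 ^ (n + 2))) hcont hmono.monotoneOn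
    hsubadd (hinv_nonneg _ (by norm_num)) (hinv_nonneg _ (by positivity))
    (fun t ht => hinv (by norm_num) ht)
    (fun t ht hφ => hinv (by positivity) ht (hφ.trans (by rw [pow_add]; linarith)))
    (hf.div_const K) hc a hh
  rw [setLIntegral_congr (halfOpenCube_ae_eq a h), measure_congr (halfOpenCube_ae_eq a h)] at key
  have hscale (x : Fin n → ℝ) : ENNReal.ofReal |f x - c a h * K|
      = ENNReal.ofReal K * ENNReal.ofReal |f x / K - c a h| := by
    rw [← ENNReal.ofReal_mul hK.le]
    congr 1
    rw [← abs_of_pos hK, ← abs_mul, abs_of_pos hK, mul_sub, mul_div_cancel₀ _ hK.ne',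
      mul_comm K]
  rw [lintegral_congr hscale, lintegral_const_mul' _ _ ENNReal.ofReal_ne_top,
    mul_comm _ K, ENNReal.ofReal_mul hK.le, mul_assoc]
  gcongr
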